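/- Let (Γ,M) be a connected GCM graph. If for every node j there is a divergent game sequence from the fundamental position ω_j, then (Γ,M) is not admissible, i.e., there is no nonzero dominant position from which some game sequence converges. -/

import Mathlib

/-- A generalized Cartan matrix on index set `I`. -/
def IsGCM {I : Type*} (M : I → I → ℤ) : Prop :=
  (∀ i, M i i = 2) ∧ (∀ i j, i ≠ j → M i j ≤ 0) ∧
    (∀ i j, i ≠ j → (M i j ≠ 0 ↔ M j i ≠ 0))

/-- Firing node `i` transforms the position `lam` by `lam j ↦ lam j - M i j * lam i`. -/
def fire {I : Type*} (M : I → I → ℤ) (lam : I → ℝ) (i : I) : I → ℝ :=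
  fun j => lam j - (M i j : ℝ) * lam i

/-- The position obtained from `lam` by firing the nodes of a list in order. -/
def fireList {I : Type*} (M : I → I → ℤ) : (I → ℝ) → List I → (I → ℝ)
  | lam, [] => lam
  | lam, i :: s => fireList M (fire M lam i) s

/-- A list of node firings is legal from `lam` if each successive firing is at a node
with a positive number. -/
def LegalSeq {I : Type*} (M : I → I → ℤ) : (I → ℝ) → List I → Prop
  | _, [] => True
  | lam, i :: s => 0 < lam i ∧ LegalSeq M (fire M lam i) s

/-- A convergent game sequence from `lam`: a legal firing sequence after which
no node has a positive number. -/
def ConvGame {I : Type*} (M : I → I → ℤ) (lam : I → ℝ) (s : List I) : Prop :=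
  LegalSeq M lam s ∧ ∀ i, fireList M lam s i ≤ 0

/-- The sequence of positions along an infinite firing sequence `f`. -/
def posSeq {I : Type*} (M : I → I → ℤ) (lam : I → ℝ) (f : ℕ → I) : ℕ → (I → ℝ)
  | 0 => lam
  | k + 1 => fire M (posSeq M lam f k) (f k)

/-- A divergent game sequence from `lam`: an infinite sequence of legal firings. -/
def DivGame {I : Type*} (M : I → I → ℤ) (lam : I → ℝ) (f : ℕ → I) : Prop :=
  ∀ k, 0 < posSeq M lam f k (f k)

theorem fireList_append {I : Type*} (M : I → I → ℤ) (s t : List I) (lam : I → ℝ) :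
    fireList M lam (s ++ t) = fireList M (fireList M lam s) t := by
  induction s generalizing lam with
  | nil => rfl
  | cons i s ih => exact ih _

theorem fireList_add_smul {I : Type*} (M : I → I → ℤ) (s : List I) (c : ℝ) (lam mu : I → ℝ) :
    fireList M (lam + c • mu) s = fireList M lam s + c • fireList M mu s := by
  induction s generalizing lam mu with
  | nil => rfl
  | cons i s ih =>
    have h : fire M (lam + c • mu) i = fire M lam i + c • fire M mu i := by
      funext j
      simp only [fire, Pi.add_apply, Pi.smul_apply, smul_eq_mul]
      ring
    simp only [fireList, h, ih]

theorem fire_self {I : Type*} {M : I → I → ℤ} (hM : IsGCM M) (lam : I → ℝ) (i : I) :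
    fire M lam i i = -lam i := by
  simp only [fire, hM.1 i]
  push_cast
  ring

theorem fire_fire {I : Type*} {M : I → I → ℤ} (hM : IsGCM M) (lam : I → ℝ) (i : I) :
    fire M (fire M lam i) i = lam := by
  funext j
  simp only [fire, hM.1 i]
  push_cast
  ring

theorem posSeq_eq_fireList {I : Type*} (M : I → I → ℤ) (lam : I → ℝ) (f : ℕ → I) (k : ℕ) :
    posSeq M lam f k = fireList M lam ((List.range k).map f) := by
  induction k with
  | zero => rfl
  | succ k ih => simp [posSeq, ih, List.range_succ, fireList_append, fireList]

/-- Two words are equivalent if they act in the same way on all positions and their lengths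
have the same parity. -/
def WordEquiv {I : Type*} (M : I → I → ℤ) (s t : List I) : Prop :=
  (∀ lam, fireList M lam s = fireList M lam t) ∧ s.length % 2 = t.length % 2

namespace WordEquiv

variable {I : Type*} {M : I → I → ℤ} {s t u s' t' : List I}

theorem refl (s : List I) : WordEquiv M s s := ⟨fun _ => rfl, rfl⟩

theorem symm (h : WordEquiv M s t) : WordEquiv M t s :=
  ⟨fun lam => (h.1 lam).symm, h.2.symm⟩

theorem trans (h : WordEquiv M s t) (h' : WordEquiv M t u) : WordEquiv M s u :=
  ⟨fun lam => (h.1 lam).trans (h'.1 lam), h.2.trans h'.2⟩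

theorem append (h : WordEquiv M s t) (h' : WordEquiv M s' t') :
    WordEquiv M (s ++ s') (t ++ t') := by
  refine ⟨fun lam => ?_, ?_⟩
  · rw [fireList_append, fireList_append, h.1, h'.1]
  · have h₁ := h.2
    have h₂ := h'.2
    simp only [List.length_append]
    omega

theorem cancel (hM : IsGCM M) (i : I) (s : List I) : WordEquiv M (i :: i :: s) s := by
  refine ⟨fun lam => ?_, ?_⟩
  · simp only [fireList, fire_fire hM]
  · simp only [List.length_cons]
    omega

theorem reverse_append_self (hM : IsGCM M) (s : List I) : WordEquiv M (s ++ s.reverse) [] := by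
  induction s with
  | nil => exact refl _
  | cons i s ih =>
    have h := ((refl [i]).append ih).append (refl (M := M) [i])
    simp only [List.append_assoc, List.reverse_cons, List.cons_append, List.nil_append] at h ⊢
    exact h.trans (cancel hM i [])

end WordEquiv

/-- A word is reduced if no equivalent word is shorter. -/
def ReducedWord {I : Type*} (M : I → I → ℤ) (s : List I) : Prop :=
  ∀ t, WordEquiv M s t → s.length ≤ t.length

namespace ReducedWord

variable {I : Type*} {M : I → I → ℤ} {s t : List I}

theorem of_equiv (hs : ReducedWord M s) (h : WordEquiv M s t) (hl : t.length ≤ s.length) :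
    ReducedWord M t :=
  fun u hu => hl.trans (hs u (h.trans hu))

theorem left (h : ReducedWord M (s ++ t)) : ReducedWord M s := by
  intro u hu
  simpa using h _ (hu.append (.refl t))

theorem right (h : ReducedWord M (s ++ t)) : ReducedWord M t := by
  intro u hu
  simpa using h _ ((WordEquiv.refl s).append hu)

theorem ne_of_cons_cons (hM : IsGCM M) {i j : I} (h : ReducedWord M (i :: j :: s)) : i ≠ j := by
  rintro rfl
  have := h _ (.cancel hM i s)
  simp only [List.length_cons] at this
  omega

end ReducedWord

theorem exists_reducedWord {I : Type*} (M : I → I → ℤ) (s : List I) :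
    ∃ t, WordEquiv M s t ∧ ReducedWord M t ∧ t.length ≤ s.length := by
  induction hn : s.length using Nat.strong_induction_on generalizing s with
  | _ n ih =>
    by_cases hs : ReducedWord M s
    · exact ⟨s, .refl s, hs, hn.le⟩
    · simp only [ReducedWord, not_forall, not_le] at hs
      obtain ⟨t, ht, hlt⟩ := hs
      obtain ⟨u, hu, hur, hul⟩ := ih _ (hn ▸ hlt) t rfl
      exact ⟨u, ht.trans hu, hur, by omega⟩

theorem exists_shorter_of_not_reducedWord {I : Type*} {M : I → I → ℤ} {w : List I} {i : I}
    (h : ¬ ReducedWord M (w ++ [i])) :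
    ∃ x, WordEquiv M (w ++ [i]) x ∧ x.length + 1 ≤ w.length := by
  simp only [ReducedWord, not_forall, not_le] at h
  obtain ⟨x, hx, hl⟩ := h
  have hp := hx.2
  simp only [List.length_append, List.length_singleton] at hl hp
  exact ⟨x, hx, by omega⟩

theorem WordEquiv.move_last {I : Type*} {M : I → I → ℤ} (hM : IsGCM M) {w x : List I} {i : I}
    (h : WordEquiv M (w ++ [i]) x) : WordEquiv M w (x ++ [i]) := by
  have h₁ := (WordEquiv.refl w).append (WordEquiv.cancel hM i []).symm
  have h₂ := h.append (.refl [i])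
  simp only [List.append_assoc, List.cons_append, List.nil_append, List.append_nil] at h₁ h₂
  exact h₁.trans h₂

/-- The alternating word `a, b, a, …` of length `n`. -/
def altWord {I : Type*} : I → I → ℕ → List I
  | _, _, 0 => []
  | a, b, n + 1 => a :: altWord b a n

theorem length_altWord {I : Type*} (a b : I) (n : ℕ) :
    (altWord a b n).length = n := by
  induction n generalizing a b with
  | zero => rfl
  | succ n ih => simp [altWord, ih]

theorem altWord_prefix {I : Type*} (a b : I) {k n : ℕ} (h : k ≤ n) :
    ∃ r, altWord a b n = altWord a b k ++ r := by
  induction k generalizing a b n with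
  | zero => exact ⟨_, rfl⟩
  | succ k ih =>
    obtain ⟨n, rfl⟩ : ∃ m, n = m + 1 := ⟨n - 1, by omega⟩
    obtain ⟨r, hr⟩ := ih b a (Nat.le_of_succ_le_succ h)
    exact ⟨r, by simp [altWord, hr]⟩

theorem ReducedWord.eq_altWord {I : Type*} {M : I → I → ℤ} (hM : IsGCM M) {a b : I}
    {l : List I} (hl : ∀ x ∈ l, x = a ∨ x = b) (h : ReducedWord M l) :
    l = altWord a b l.length ∨ l = altWord b a l.length := by
  induction l with
  | nil => exact .inl rfl
  | cons i l ih =>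
    have ih := ih (fun x hx => hl x (by simp [hx])) (h.right (s := [i]))
    cases l with
    | nil => rcases hl i (by simp) with rfl | rfl <;> simp [altWord]
    | cons j l =>
      have hij := h.ne_of_cons_cons hM
      have hi := hl i (by simp)
      simp only [List.length_cons, altWord, List.cons.injEq] at ih ⊢
      rcases ih with ⟨rfl, ih⟩ | ⟨rfl, ih⟩
      · exact .inr ⟨by tauto, rfl, ih⟩
      · exact .inl ⟨by tauto, rfl, ih⟩

/-- Every firing in the word is at a node with a nonnegative number. -/
def NonnegSeq {I : Type*} (M : I → I → ℤ) : (I → ℝ) → List I → Prop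
  | _, [] => True
  | lam, i :: s => 0 ≤ lam i ∧ NonnegSeq M (fire M lam i) s

theorem NonnegSeq.last_nonneg {I : Type*} {M : I → I → ℤ} {lam : I → ℝ} {u : List I} {i : I}
    (h : NonnegSeq M lam (u ++ [i])) : 0 ≤ fireList M lam u i := by
  induction u generalizing lam with
  | nil => exact h.1
  | cons j u ih => exact ih h.2

theorem NonnegSeq.left {I : Type*} {M : I → I → ℤ} {lam : I → ℝ} {u v : List I}
    (h : NonnegSeq M lam (u ++ v)) : NonnegSeq M lam u := by
  induction u generalizing lam with
  | nil => trivial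
  | cons j u ih => exact ⟨h.1, ih h.2⟩

theorem nonnegSeq_altWord_of_bound {I : Type*} {M : I → I → ℤ} (hM : IsGCM M) {a b : I}
    (hab : a ≠ b) (h4 : 4 ≤ M a b * M b a) (n : ℕ) {mu : I → ℝ} (ha : 0 ≤ mu a)
    (hb : 0 ≤ -(M a b : ℝ) * mu a + 2 * mu b) : NonnegSeq M mu (altWord a b n) := by
  induction n generalizing a b mu with
  | zero => trivial
  | succ n ih =>
    have hp : (M a b : ℝ) ≤ 0 := by exact_mod_cast hM.2.1 a b hab
    have hq : (M b a : ℝ) ≤ 0 := by exact_mod_cast hM.2.1 b a hab.symm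
    have h4' : (4 : ℝ) ≤ M a b * M b a := by exact_mod_cast h4
    refine ⟨ha, ih hab.symm (by rwa [mul_comm]) ?_ ?_⟩
    · simp only [fire]
      nlinarith
    · rw [fire_self hM]
      simp only [fire]
      nlinarith [mul_nonneg (neg_nonneg.2 hq) hb, mul_nonneg (sub_nonneg.2 h4') ha]

theorem not_reducedWord_of_braid {I : Type*} {M : I → I → ℤ} (hM : IsGCM M) {a b : I} {m n : ℕ}
    (hbraid : ∀ lam, fireList M lam (altWord a b (m + 1)) =
      fireList M lam (altWord b a (m + 1)))
    (hn : m + 1 < n) : ¬ ReducedWord M (altWord a b n) := by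
  intro h
  obtain ⟨r, hr⟩ := altWord_prefix a b (Nat.succ_le_of_lt hn)
  rw [hr] at h
  have he : WordEquiv M (altWord b a (m + 1)) (altWord a b (m + 1)) :=
    ⟨fun lam => (hbraid lam).symm, by simp [length_altWord]⟩
  have h' := h.left _ (((WordEquiv.refl [a]).append he).trans (.cancel hM a _))
  simp only [length_altWord] at h'
  omega

theorem gcm_pair_cases {p q : ℤ} (hp : p ≤ 0) (hq : q ≤ 0) (h : p ≠ 0 ↔ q ≠ 0)
    (h4 : p * q < 4) :
    (p = 0 ∧ q = 0) ∨ (p = -1 ∧ q = -1) ∨ (p = -1 ∧ q = -2) ∨ (p = -2 ∧ q = -1) ∨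
      (p = -1 ∧ q = -3) ∨ (p = -3 ∧ q = -1) := by
  by_cases hp0 : p = 0
  · have : q = 0 := by tauto
    simp [hp0, this]
  · have hq0 : q ≠ 0 := h.1 hp0
    have hp' : p ≤ -1 := by omega
    have hq' : q ≤ -1 := by omega
    have : -4 < p := by nlinarith
    have : -4 < q := by nlinarith
    interval_cases p <;> interval_cases q <;> simp_all

theorem nonnegSeq_altWord {I : Type*} {M : I → I → ℤ} (hM : IsGCM M) {a b : I}
    (hab : a ≠ b) {n : ℕ} (h : ReducedWord M (altWord a b n)) {mu : I → ℝ}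
    (ha : 0 ≤ mu a) (hb : 0 ≤ mu b) : NonnegSeq M mu (altWord a b n) := by
  rcases le_or_gt 4 (M a b * M b a) with h4 | h4
  · refine nonnegSeq_altWord_of_bound hM hab h4 n ha ?_
    have hp : (M a b : ℝ) ≤ 0 := by exact_mod_cast hM.2.1 a b hab
    nlinarith
  have haa := hM.1 a
  have hbb := hM.1 b
  obtain ⟨m, hbraid, hm⟩ : ∃ m, (∀ lam, fireList M lam (altWord a b (m + 1)) =
      fireList M lam (altWord b a (m + 1))) ∧
      NonnegSeq M mu (altWord a b (m + 1)) := by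
    rcases gcm_pair_cases (hM.2.1 a b hab) (hM.2.1 b a hab.symm) (hM.2.2 a b hab) h4 with
      ⟨hp, hq⟩ | ⟨hp, hq⟩ | ⟨hp, hq⟩ | ⟨hp, hq⟩ | ⟨hp, hq⟩ | ⟨hp, hq⟩
    · use 1
      constructor
      · intro lam
        funext k
        simp only [altWord, fireList, fire, hp, hq]
        push_cast
        ring
      · simp only [altWord, NonnegSeq, fire, hp]
        push_cast
        refine ⟨?_, ?_, trivial⟩ <;> linarith
    · use 2
      constructor
      · intro lam
        funext k
        simp only [altWord, fireList, fire, haa, hbb, hp, hq]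
        push_cast
        ring
      · simp only [altWord, NonnegSeq, fire, haa, hp, hq]
        push_cast
        refine ⟨?_, ?_, ?_, trivial⟩ <;> linarith
    iterate 2
      · use 3
        constructor
        · intro lam
          funext k
          simp only [altWord, fireList, fire, haa, hbb, hp, hq]
          push_cast
          ring
        · simp only [altWord, NonnegSeq, fire, haa, hbb, hp, hq]
          push_cast
          refine ⟨?_, ?_, ?_, ?_, trivial⟩ <;> linarith
    iterate 2
      · use 5
        constructor
        · intro lam
          funext k
          simp only [altWord, fireList, fire, haa, hbb, hp, hq]
          push_cast
          ring
        · simp only [altWord, NonnegSeq, fire, haa, hbb, hp, hq]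
          push_cast
          refine ⟨?_, ?_, ?_, ?_, ?_, ?_, trivial⟩ <;> linarith
  obtain ⟨r, hr⟩ := altWord_prefix a b
    (not_lt.1 fun hn => not_reducedWord_of_braid hM hbraid hn h)
  rw [hr] at hm
  exact hm.left

theorem nonneg_of_reducedWord_append {I : Type*} {M : I → I → ℤ} (hM : IsGCM M) {w : List I}
    {s : I} (h : ReducedWord M (w ++ [s])) {lam : I → ℝ} (hlam : ∀ i, 0 ≤ lam i) :
    0 ≤ fireList M lam w s := by
  induction hn : w.length using Nat.strong_induction_on generalizing w s with
  | _ n ih =>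
    rcases List.eq_nil_or_concat w with rfl | ⟨w', t, hw⟩
    · exact hlam s
    have hst : t ≠ s := by
      rw [hw, List.concat_eq_append, List.append_assoc] at h
      exact h.right.ne_of_cons_cons hM
    classical
    have hex : ∃ k, ∃ v u : List I, v.length = k ∧ (∀ x ∈ u, x = s ∨ x = t) ∧
        WordEquiv M (v ++ u) w ∧ v.length + u.length = w.length :=
      ⟨_, w', [t], rfl, by simp, by rw [hw, List.concat_eq_append]; exact .refl _, by simp [hw]⟩
    obtain ⟨v, u, hv, hu, he, hl⟩ := Nat.find_spec hex
    have hmin := fun k => Nat.find_min' hex (m := k)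
    rw [← hv] at hmin
    have hvn : v.length < n := by
      have := hmin w'.length ⟨w', [t], rfl, by simp,
        by rw [hw, List.concat_eq_append]; exact .refl _, by simp [hw]⟩
      rw [← hn, hw, List.length_concat]
      omega
    have hred : ∀ c, c = s ∨ c = t → ReducedWord M (v ++ [c]) := by
      intro c hc
      by_contra hnr
      obtain ⟨x, hx, hxl⟩ := exists_shorter_of_not_reducedWord hnr
      have hx' := ((hx.move_last hM).append (.refl u)).symm.trans he
      have hwl := h.left _ hx'.symm
      simp only [List.append_assoc, List.cons_append, List.nil_append] at hx'
      simp only [List.length_append, List.length_singleton] at hwl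
      have := hmin x.length ⟨x, c :: u, rfl, by simpa [hc] using hu, hx', by
        simp only [List.length_cons]; omega⟩
      omega
    have hs := ih _ hvn (hred s (.inl rfl)) rfl
    have ht := ih _ hvn (hred t (.inr rfl)) rfl
    have hus : ReducedWord M (u ++ [s]) := by
      have := h.of_equiv (he.symm.append (.refl [s])) (by simp; omega)
      rw [List.append_assoc] at this
      exact this.right
    have hus' : ∀ x ∈ u ++ [s], x = s ∨ x = t := by
      simpa [or_imp, forall_and] using hu
    rw [← he.1, fireList_append]
    apply NonnegSeq.last_nonneg
    rcases hus.eq_altWord hM hus' with h' | h' <;> rw [h'] at hus ⊢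
    · exact nonnegSeq_altWord hM hst.symm hus hs ht
    · exact nonnegSeq_altWord hM hst hus ht hs

theorem DivGame.reducedWord {I : Type*} {M : I → I → ℤ} (hM : IsGCM M) {lam : I → ℝ}
    (hlam : ∀ i, 0 ≤ lam i) {f : ℕ → I} (hf : DivGame M lam f) (k : ℕ) :
    ReducedWord M ((List.range k).map f) := by
  induction k with
  | zero => exact fun t _ => Nat.zero_le _
  | succ k ih =>
    rw [List.range_succ, List.map_append, List.map_singleton]
    by_contra hnr
    obtain ⟨x, hx, hxl⟩ := exists_shorter_of_not_reducedWord hnr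
    have hx' := hx.move_last hM
    have hpos := nonneg_of_reducedWord_append hM
      (ih.of_equiv hx' (by simpa using hxl)) hlam
    have hk := hf k
    rw [posSeq_eq_fireList, hx'.1, fireList_append] at hk
    simp only [fireList, fire_self hM] at hk
    linarith

theorem DivGame.of_smul_le {I : Type*} {M : I → I → ℤ} (hM : IsGCM M) {lam mu : I → ℝ}
    (hmu : ∀ i, 0 ≤ mu i) {f : ℕ → I} (hf : DivGame M mu f) {c : ℝ} (hc : 0 < c)
    (hle : ∀ i, c * mu i ≤ lam i) : DivGame M lam f := by
  intro k
  have hred := hf.reducedWord hM hmu (k + 1)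
  rw [List.range_succ, List.map_append, List.map_singleton] at hred
  have h₁ := nonneg_of_reducedWord_append hM hred (lam := lam - c • mu)
    (fun i => sub_nonneg.2 (hle i))
  have h₂ := hf k
  rw [posSeq_eq_fireList] at h₂ ⊢
  rw [← sub_add_cancel lam (c • mu), fireList_add_smul]
  simp only [Pi.add_apply, Pi.smul_apply, smul_eq_mul]
  positivity

theorem not_divGame_of_fireList_nonpos {I : Type*} {M : I → I → ℤ} (hM : IsGCM M) {lam : I → ℝ}
    {s : List I} (hs : ∀ i, fireList M lam s i ≤ 0) (f : ℕ → I) : ¬ DivGame M lam f := by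
  intro hf
  have key : ∀ k, ∃ y, WordEquiv M (s.reverse ++ (List.range k).map f) y ∧
      ReducedWord M y ∧ y.length + k ≤ s.length := by
    intro k
    induction k with
    | zero => simpa using exists_reducedWord M s.reverse
    | succ k ih =>
      obtain ⟨y, hy, -, hyl⟩ := ih
      have hnr : ¬ ReducedWord M (y ++ [f k]) := by
        intro hr
        have h₁ := nonneg_of_reducedWord_append hM hr
          (lam := 0 + (-1 : ℝ) • fireList M lam s) (fun i => by simpa using hs i)
        have h₂ := hf k
        have h₃ := (WordEquiv.reverse_append_self hM s).append (.refl ((List.range k).map f))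
        rw [List.append_assoc, List.nil_append] at h₃
        rw [posSeq_eq_fireList, ← h₃.1, fireList_append, hy.1] at h₂
        have h₀ : fireList M 0 y = 0 := by
          simpa using fireList_add_smul M y (-1) 0 0
        rw [fireList_add_smul, h₀] at h₁
        simp only [Pi.add_apply, Pi.zero_apply, Pi.smul_apply, smul_eq_mul] at h₁
        linarith
      obtain ⟨x, hx, hxl⟩ := exists_shorter_of_not_reducedWord hnr
      obtain ⟨z, hz, hzr, hzl⟩ := exists_reducedWord M x
      refine ⟨z, ?_, hzr, by omega⟩
      rw [List.range_succ, List.map_append, List.map_singleton, ← List.append_assoc]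
      exact ((hy.append (.refl [f k])).trans hx).trans hz
  obtain ⟨y, -, -, hy⟩ := key (s.length + 1)
  omega

/-- If from every fundamental position there is a divergent game sequence, then the
connected GCM graph is not admissible: no nonzero dominant position has a convergent
game sequence. -/
theorem not_admissible {I : Type*} [Fintype I] [DecidableEq I]
    (M : I → I → ℤ) (hM : IsGCM M)
    (hconn : (SimpleGraph.fromRel fun i j => M i j ≠ 0).Connected)
    (hdiv : ∀ j : I, ∃ f : ℕ → I, DivGame M (fun i => if i = j then 1 else 0) f) :
    ¬ ∃ lam : I → ℝ, (∀ i, 0 ≤ lam i) ∧ (∃ i, lam i ≠ 0) ∧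
      ∃ s : List I, ConvGame M lam s := by
  rintro ⟨lam, hlam, ⟨j, hj⟩, s, -, hs⟩
  obtain ⟨f, hf⟩ := hdiv j
  refine not_divGame_of_fireList_nonpos hM hs f
    (hf.of_smul_le hM (fun i => ?_) ((hlam j).lt_of_ne' hj) fun i => ?_)
  · split_ifs <;> norm_num
  · split_ifs with h
    · simp [h]
    · simpa using hlam i
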